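/- Let E = [−1,1] ⊂ ℝ. For every real polynomial p of degree at most r with sup_{[−1,1]} |p| ≤ 1, and for all x, y ∈ [−1,1], one has |arccos(p(x)) − arccos(p(y))| ≤ r · |arccos(x) − arccos(y)|. -/

import Mathlib

open Polynomial Set

lemma aux_re_le (g : ℂ[X]) (N : ℕ) (hdeg : g.natDegree ≤ N)
    (h : ∀ z : ℂ, ‖z‖ ≤ 1 → g.eval z ≠ 0) (z : ℂ) (hz : ‖z‖ = 1) :
    (z * (g.derivative.eval z / g.eval z)).re ≤ N / 2 := by
  have hs : g.Splits := IsAlgClosed.splits g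
  rw [hs.eval_derivative_div_eval_of_ne_zero (h z hz.le)]
  have key : ∀ s : Multiset ℂ, (∀ w ∈ s, 1 < ‖w‖) →
      (z * (s.map fun w ↦ 1 / (z - w)).sum).re ≤ (s.card : ℝ) / 2 := by
    intro s
    induction s using Multiset.induction_on with
    | empty => simp
    | cons a s ih =>
      intro hs
      have h1 := ih (fun w hw => hs w (Multiset.mem_cons_of_mem hw))
      have h2 := hs a (Multiset.mem_cons_self a s)
      have h3 : (z * (1 / (z - a))).re ≤ 1 / 2 := by
        have hza : z - a ≠ 0 := by
          intro h0
          rw [sub_eq_zero.1 h0] at hz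
          linarith
        have hpos : 0 < Complex.normSq (z - a) := Complex.normSq_pos.2 hza
        have e1 : z.re * z.re + z.im * z.im = 1 := by
          have := Complex.normSq_eq_norm_sq z
          rw [hz, Complex.normSq_apply] at this
          simpa using this
        have e2 : 1 ≤ a.re * a.re + a.im * a.im := by
          have := Complex.normSq_eq_norm_sq a
          rw [Complex.normSq_apply] at this
          nlinarith
        rw [mul_one_div, Complex.div_re, ← add_div, div_le_div_iff₀ hpos two_pos] 
        rw [Complex.normSq_apply]
        simp only [Complex.sub_re, Complex.sub_im]
        nlinarith
      rw [Multiset.map_cons, Multiset.sum_cons, mul_add, Complex.add_re, Multiset.card_cons]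
      push_cast
      linarith
  refine (key g.roots ?_).trans ?_
  · intro w hw
    by_contra hcon
    exact h w (not_lt.1 hcon) (isRoot_of_mem_roots hw)
  · have : (g.roots.card : ℝ) ≤ N := by exact_mod_cast (card_roots' g).trans hdeg
    linarith

/-- `z^r p((z+1/z)/2)` as a polynomial. -/
lemma aux_lift (r : ℕ) (p : ℝ[X]) (hdeg : p.natDegree ≤ r) :
    ∃ f : ℂ[X], f.natDegree ≤ 2 * r ∧ ∀ θ : ℝ,
      f.eval (Complex.exp (θ * Complex.I)) =
        Complex.exp (θ * Complex.I) ^ r * ((p.eval (Real.cos θ) : ℝ) : ℂ) := by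
  refine ⟨∑ k ∈ Finset.range (r + 1),
    C ((p.coeff k : ℂ) * (1 / 2) ^ k) * (X ^ 2 + 1) ^ k * X ^ (r - k), ?_, ?_⟩
  · apply natDegree_sum_le_of_forall_le
    intro k hk
    have hk' : k ≤ r := by simpa [Nat.lt_succ_iff] using hk
    have h1 : ((X ^ 2 + 1 : ℂ[X]) ^ k).natDegree ≤ k * 2 := by
      refine natDegree_pow_le.trans (Nat.mul_le_mul_left _ ?_)
      compute_degree
    refine natDegree_mul_le.trans ?_
    rw [natDegree_X_pow]
    have h2 := natDegree_C_mul_le ((p.coeff k : ℂ) * (1 / 2) ^ k) ((X ^ 2 + 1 : ℂ[X]) ^ k)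
    omega
  · intro θ
    rw [eval_finsetSum, eval_eq_sum_range' (Nat.lt_succ_of_le hdeg), Complex.ofReal_sum,
      Finset.mul_sum]
    refine Finset.sum_congr rfl fun k hk => ?_
    have hk' : k ≤ r := by simpa [Nat.lt_succ_iff] using hk
    have hc : Complex.exp (θ * Complex.I) ^ 2 + 1 =
        2 * (Complex.exp (θ * Complex.I) * Complex.cos θ) := by
      rw [Complex.cos, neg_mul, Complex.exp_neg]
      have := Complex.exp_ne_zero (θ * Complex.I)
      field_simp
    simp only [eval_mul, eval_C, eval_pow, eval_add, eval_X, eval_one]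
    rw [hc]
    push_cast
    obtain ⟨m, rfl⟩ := Nat.exists_eq_add_of_le hk'
    rw [Nat.add_sub_cancel_left, pow_add, mul_pow, mul_pow, one_div, inv_pow]
    field_simp

lemma aux_bernstein (r : ℕ) (p : ℝ[X]) (hdeg : p.natDegree ≤ r) (c : ℝ) (hc : c < 1)
    (hb : ∀ x ∈ Icc (-1 : ℝ) 1, |p.eval x| ≤ c) (θ : ℝ) :
    (p.derivative.eval (Real.cos θ) * -Real.sin θ) ^ 2 ≤
      (r : ℝ) ^ 2 * (1 - p.eval (Real.cos θ) ^ 2) := by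
  obtain ⟨f, hfd, hf⟩ := aux_lift r p hdeg
  have hder : ∀ θ : ℝ, HasDerivAt (fun θ : ℝ => p.eval (Real.cos θ))
      (p.derivative.eval (Real.cos θ) * -Real.sin θ) θ := fun θ =>
    (p.hasDerivAt (Real.cos θ)).comp θ (Real.hasDerivAt_cos θ)
  set T := p.eval (Real.cos θ) with hT
  set D := p.derivative.eval (Real.cos θ) * -Real.sin θ with hD
  have hcos : ∀ t, |p.eval (Real.cos t)| ≤ c := fun t => hb _ ⟨Real.neg_one_le_cos t, Real.cos_le_one t⟩
  -- norm bound
  have hfb : ∀ z : ℂ, ‖z‖ ≤ 1 → ‖f.eval z‖ ≤ c := by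
    intro z hz
    refine Complex.norm_le_of_forall_mem_frontier_norm_le (U := Metric.ball (0 : ℂ) 1)
      Metric.isBounded_ball (f := fun z => f.eval z) f.differentiable.diffContOnCl ?_ ?_
    · intro w hw
      rw [frontier_ball (0 : ℂ) one_ne_zero, mem_sphere_zero_iff_norm] at hw
      have : w = Complex.exp (w.arg * Complex.I) := by
        have := Complex.norm_mul_exp_arg_mul_I w
        rw [hw] at this
        simpa using this.symm
      rw [this, hf, norm_mul, norm_pow, Complex.norm_exp_ofReal_mul_I, one_pow, one_mul,
        Complex.norm_real]
      exact hcos _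
    · rw [closure_ball (0 : ℂ) one_ne_zero]
      simpa using hz
  set z := Complex.exp (θ * Complex.I) with hz
  have hz0 : z ≠ 0 := Complex.exp_ne_zero _
  have hz1 : ‖z‖ = 1 := Complex.norm_exp_ofReal_mul_I θ
  -- derivative
  have hzd : HasDerivAt (fun t : ℝ => Complex.exp (t * Complex.I)) (z * Complex.I) θ := by
    have h1 : HasDerivAt (fun t : ℝ => (t : ℂ) * Complex.I) (1 * Complex.I) θ :=
      (Complex.ofRealCLM.hasDerivAt (x := θ)).mul_const Complex.I
    simpa using h1.cexp
  have hzf : z * f.derivative.eval z = z ^ r * (r * T - Complex.I * D) := by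
    have h1 : HasDerivAt (fun t : ℝ => f.eval (Complex.exp (t * Complex.I)))
        (f.derivative.eval z * (z * Complex.I)) θ :=
      HasDerivAt.comp (h₂ := fun w : ℂ => f.eval w) (h := fun t : ℝ => Complex.exp (t * Complex.I)) θ
        (f.hasDerivAt _) hzd
    have h2 := (hzd.pow r).mul (hder θ).ofReal_comp
    have h3 : (fun t : ℝ => f.eval (Complex.exp (t * Complex.I))) = 
      (fun t : ℝ => Complex.exp (t * Complex.I)) ^ r * (fun t : ℝ => ((p.eval (Real.cos t) : ℝ) : ℂ)) := by
      funext t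
      simp [hf]
    rw [h3] at h1
    have h4 := h1.unique h2
    have h5 : (r : ℂ) * z ^ (r - 1) * z = r * z ^ r := by
      rcases r with _ | r
      · simp
      · simp [pow_succ, mul_assoc]
    simp only [Pi.pow_apply, ← hz, ← hT, ← hD] at h4
    linear_combination (-Complex.I) * h4 + T * h5 * (-Complex.I^2) + (z * f.derivative.eval z - r * T * z ^ r) * Complex.I_sq
  by_cases hS : (r : ℝ) ^ 2 * T ^ 2 + D ^ 2 = 0
  · nlinarith [sq_nonneg (r : ℝ)]
  have hSpos : 0 < (r : ℝ) ^ 2 * T ^ 2 + D ^ 2 := lt_of_le_of_ne (by positivity) (Ne.symm hS)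
  set S := Real.sqrt ((r : ℝ) ^ 2 * T ^ 2 + D ^ 2) with hSdef
  have hS0 : 0 < S := Real.sqrt_pos.2 hSpos
  have hS2 : S ^ 2 = (r : ℝ) ^ 2 * T ^ 2 + D ^ 2 := Real.sq_sqrt hSpos.le
  obtain ⟨a, ha⟩ : ∃ a, a = -(r * T) / S := ⟨_, rfl⟩
  obtain ⟨b, hb'⟩ : ∃ b, b = -D / S := ⟨_, rfl⟩
  have hab : a * a + b * b = 1 := by
    rw [ha, hb']; field_simp; linarith
  have habS : - r * a * T - b * D = S := by
    rw [ha, hb']; field_simp; linarith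
  set μ : ℂ := ⟨a, b⟩ with hμ
  have hμ1 : ‖μ‖ = 1 := by
    have := Complex.normSq_eq_norm_sq μ
    rw [Complex.normSq_apply] at this
    have h2 : ‖μ‖ ^ 2 = 1 := by rw [← this]; exact hab
    nlinarith [norm_nonneg μ]
  have hne : ∀ w : ℂ, ‖w‖ ≤ 1 → (f + C (z ^ r * μ)).eval w ≠ 0 := by
    intro w hw h0
    rw [eval_add, eval_C] at h0
    have h1 := hfb w hw
    rw [eq_neg_of_add_eq_zero_left h0, norm_neg, norm_mul, norm_pow, hz1, hμ1] at h1
    norm_num at h1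
    linarith
  have hA := aux_re_le (f + C (z ^ r * μ)) (2 * r) (by
    refine (natDegree_add_le _ _).trans ?_
    rw [natDegree_C]
    simpa using hfd) hne z hz1
  have hne' := hne z hz1.le
  have hgz : (f + C (z ^ r * μ)).eval z = z ^ r * (T + μ) := by
    rw [eval_add, eval_C, hf θ]; ring
  rw [hgz] at hne'
  have hTm : (T + μ : ℂ) ≠ 0 := right_ne_zero_of_mul hne'
  have hq : z * ((f + C (z ^ r * μ)).derivative.eval z / (f + C (z ^ r * μ)).eval z) =
      (r * T - Complex.I * D) / (T + μ) := by
    rw [hgz, derivative_add, derivative_C, add_zero, ← mul_div_assoc, hzf,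
      mul_div_mul_left _ _ (pow_ne_zero _ hz0)]
  rw [hq, Complex.div_re, ← add_div, div_le_iff₀ (Complex.normSq_pos.2 hTm),
    Complex.normSq_apply] at hA
  simp [hμ] at hA
  have hSr : S ≤ r := by nlinarith
  nlinarith

lemma aux_strict (r : ℕ) (p : ℝ[X]) (hdeg : p.natDegree ≤ r) (c : ℝ) (hc : c < 1)
    (hb : ∀ x ∈ Icc (-1 : ℝ) 1, |p.eval x| ≤ c) (s t : ℝ) :
    |Real.arccos (p.eval (Real.cos s)) - Real.arccos (p.eval (Real.cos t))| ≤ r * |s - t| := by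
  have hcos : ∀ t, |p.eval (Real.cos t)| < 1 := fun t =>
    (hb _ ⟨Real.neg_one_le_cos t, Real.cos_le_one t⟩).trans_lt hc
  have hd : ∀ θ : ℝ, HasDerivAt (fun θ : ℝ => Real.arccos (p.eval (Real.cos θ)))
      (-(1 / √(1 - p.eval (Real.cos θ) ^ 2)) *
        (p.derivative.eval (Real.cos θ) * -Real.sin θ)) θ := fun θ =>
    HasDerivAt.comp (h₂ := Real.arccos) (h := fun θ : ℝ => p.eval (Real.cos θ)) θ
      (Real.hasDerivAt_arccos (abs_lt.1 (hcos θ)).1.ne' (abs_lt.1 (hcos θ)).2.ne)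
      ((p.hasDerivAt (Real.cos θ)).comp θ (Real.hasDerivAt_cos θ))
  refine Convex.norm_image_sub_le_of_norm_hasDerivWithin_le
    (fun x _ => (hd x).hasDerivWithinAt) ?_ convex_univ (mem_univ t) (mem_univ s)
  intro x _
  have hpos : 0 < 1 - p.eval (Real.cos x) ^ 2 := by
    have := (sq_lt_one_iff_abs_lt_one _).2 (hcos x)
    linarith
  rw [norm_mul, norm_neg, Real.norm_eq_abs, Real.norm_eq_abs, abs_of_nonneg (by positivity),
    one_div_mul_eq_div, div_le_iff₀ (Real.sqrt_pos.2 hpos)]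
  apply abs_le_of_sq_le_sq _ (by positivity)
  rw [mul_pow (r : ℝ), Real.sq_sqrt hpos.le]
  exact aux_bernstein r p hdeg c hc hb x

/-- Van der Corput–Schaake type inequality: if `p` is a real polynomial of degree
at most `r` with `|p| ≤ 1` on `[−1,1]`, then for all `x, y ∈ [−1,1]`,
`|arccos(p(x)) − arccos(p(y))| ≤ r·|arccos x − arccos y|`. -/
theorem arccos_polynomial_lipschitz (r : ℕ) (p : Polynomial ℝ)
    (hdeg : p.natDegree ≤ r)
    (hbound : ∀ x ∈ Icc (-1 : ℝ) 1, |p.eval x| ≤ 1) :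
    ∀ x ∈ Icc (-1 : ℝ) 1, ∀ y ∈ Icc (-1 : ℝ) 1,
      |Real.arccos (p.eval x) - Real.arccos (p.eval y)| ≤
        r * |Real.arccos x - Real.arccos y| := by
  intro x hx y hy
  have h : ∀ c ∈ Ioo (0 : ℝ) 1,
      |Real.arccos (c * p.eval x) - Real.arccos (c * p.eval y)| ≤
        r * |Real.arccos x - Real.arccos y| := by
    intro c hc
    have := aux_strict r (C c * p) ((natDegree_C_mul_le c p).trans hdeg) c hc.2 (by
      intro w hw
      rw [eval_mul, eval_C, abs_mul, abs_of_pos hc.1]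
      exact mul_le_of_le_one_right hc.1.le (hbound w hw)) (Real.arccos x) (Real.arccos y)
    simpa [Real.cos_arccos hx.1 hx.2, Real.cos_arccos hy.1 hy.2] using this
  have hcont : Continuous fun c : ℝ =>
      |Real.arccos (c * p.eval x) - Real.arccos (c * p.eval y)| := by
    have := Real.continuous_arccos
    fun_prop
  have h1 : (1 : ℝ) ∈ closure (Ioo (0 : ℝ) 1) := by
    rw [closure_Ioo zero_ne_one]; simp
  have : (1 : ℝ) ∈ {c : ℝ | |Real.arccos (c * p.eval x) - Real.arccos (c * p.eval y)| ≤
      r * |Real.arccos x - Real.arccos y|} :=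
    closure_minimal h (isClosed_le hcont continuous_const) h1
  simpa using this
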